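/- arXiv:1504.06433 — 3 statements merged into one kernel-verified Lean document; each statement's English description precedes it below -/
import Mathlib

section
/- For k = 2, let ν be a probability measure on (0,∞)² with νQ = ν and with support contained in [2,8]². Then the support of ν equals Θ_2. -/
open MeasureTheory ProbabilityTheory Real Finset

noncomputable section

/-- `E_{τ,i}`: the set of `j ∈ {1,…,k}` with `min(τ(j-1),τ(j)) < i ≤ max(τ(j-1),τ(j))`
(index `j : Fin k` represents `j+1`, `i : Fin k` represents `i+1`). -/
def Eset {k : ℕ} (τ : Equiv.Perm (Fin (k + 1))) (i : Fin k) : Finset (Fin k) :=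
  Finset.univ.filter (fun j : Fin k =>
    min ((τ j.castSucc : Fin (k + 1)) : ℕ) ((τ j.succ : Fin (k + 1)) : ℕ) < (i : ℕ) + 1 ∧
      (i : ℕ) + 1 ≤ max ((τ j.castSucc : Fin (k + 1)) : ℕ) ((τ j.succ : Fin (k + 1)) : ℕ))

/-- `F_{τ,i}(λ) = Σ_{j ∈ E_{τ,i}} √(2 λ_j)`. -/
def F {k : ℕ} (τ : Equiv.Perm (Fin (k + 1))) (i : Fin k) (l : Fin k → ℝ) : ℝ :=
  ∑ j ∈ Eset τ i, Real.sqrt (2 * l j)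

/-- `w_τ(λ) = 2^{-k} Π_i √(2 λ_i) / F_{τ,i}(λ)`. -/
def w {k : ℕ} (τ : Equiv.Perm (Fin (k + 1))) (l : Fin k → ℝ) : ℝ :=
  (2 : ℝ)⁻¹ ^ k * ∏ i : Fin k, Real.sqrt (2 * l i) / F τ i l

/-- The Markov kernel `Q(λ, ·) = Σ_{τ ∈ S(0..k)} w_τ(λ) δ_{F_τ(λ)}` at the parameter
level; `ν.bind Qker` is the measure `νQ : A ↦ ∫ Σ_τ w_τ(λ) 1_{F_τ(λ) ∈ A} dν(λ)`. -/
def Qker {k : ℕ} (l : Fin k → ℝ) : Measure (Fin k → ℝ) :=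
  ∑ τ : Equiv.Perm (Fin (k + 1)),
    ENNReal.ofReal (w τ l) • Measure.dirac (fun i => F τ i l)

/-- `Θ_k^{(0)} = [2,2k²]^k` and `Θ_k^{(n)} = ⋃_τ F_τ(Θ_k^{(n-1)})`;
`⋂ n, Theta k n` is the set `Θ_k`. -/
def Theta (k : ℕ) : ℕ → Set (Fin k → ℝ)
  | 0 => {l | ∀ i, l i ∈ Set.Icc (2 : ℝ) (2 * (k : ℝ) ^ 2)}
  | n + 1 => ⋃ τ : Equiv.Perm (Fin (k + 1)), (fun l (i : Fin k) => F τ i l) '' Theta k n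

/-- The support of a measure: points all of whose open neighbourhoods have
positive measure. -/
def msupport {k : ℕ} (ν : Measure (Fin k → ℝ)) : Set (Fin k → ℝ) :=
  {x | ∀ U : Set (Fin k → ℝ), IsOpen U → x ∈ U → 0 < ν U}

/-- The map `F_τ` on the whole parameter vector. -/
def Fmap {k : ℕ} (τ : Equiv.Perm (Fin (k + 1))) (l : Fin k → ℝ) : Fin k → ℝ :=
  fun i => F τ i l

theorem continuous_F {k : ℕ} (τ : Equiv.Perm (Fin (k + 1))) (i : Fin k) :
    Continuous (F τ i) := by
  unfold F
  fun_prop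

theorem continuous_Fmap {k : ℕ} (τ : Equiv.Perm (Fin (k + 1))) : Continuous (Fmap τ) :=
  continuous_pi (continuous_F τ)

theorem measurable_w {k : ℕ} (τ : Equiv.Perm (Fin (k + 1))) : Measurable (w τ) := by
  have h (i : Fin k) : Measurable (F τ i) := (continuous_F τ i).measurable
  unfold w
  fun_prop

theorem Qker_apply {k : ℕ} (l : Fin k → ℝ) {s : Set (Fin k → ℝ)} (hs : MeasurableSet s) :
    Qker l s = ∑ τ, ENNReal.ofReal (w τ l) * s.indicator 1 (Fmap τ l) := by
  simp only [Qker, Measure.finsetSum_apply, Measure.smul_apply, smul_eq_mul,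
    Measure.dirac_apply' _ hs]
  rfl

theorem measurable_Qker {k : ℕ} : Measurable (Qker (k := k)) := by
  refine Measure.measurable_of_measurable_coe _ fun s hs => ?_
  simp_rw [Qker_apply _ hs]
  refine Finset.measurable_sum _ fun τ _ => (measurable_w τ).ennreal_ofReal.mul ?_
  exact (measurable_one.indicator hs).comp (continuous_Fmap τ).measurable

theorem msupport_eq_support {k : ℕ} (ν : Measure (Fin k → ℝ)) : msupport ν = ν.support := by
  ext x
  rw [(nhds_basis_opens x).mem_measureSupport]
  exact ⟨fun h U hU => h U hU.2 hU.1, fun h U hU hx => h U ⟨hx, hU⟩⟩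

theorem isCompact_Theta (k n : ℕ) : IsCompact (Theta k n) := by
  induction n with
  | zero => exact isCompact_pi_infinite fun _ => isCompact_Icc
  | succ n ih => exact isCompact_iUnion fun τ => ih.image (continuous_Fmap τ)

theorem Fmap_mem_Theta {k n : ℕ} (τ : Equiv.Perm (Fin (k + 1))) {l : Fin k → ℝ}
    (hl : l ∈ Theta k n) : Fmap τ l ∈ Theta k (n + 1) :=
  Set.mem_iUnion.2 ⟨τ, l, hl, rfl⟩

theorem measure_compl_Theta {k : ℕ} {ν : Measure (Fin k → ℝ)} (hfix : ν.bind Qker = ν)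
    (h0 : ν (Theta k 0)ᶜ = 0) (n : ℕ) : ν (Theta k n)ᶜ = 0 := by
  induction n with
  | zero => exact h0
  | succ n ih =>
    have hm := (isCompact_Theta k (n + 1)).measurableSet.compl
    rw [← hfix, Measure.bind_apply hm measurable_Qker.aemeasurable]
    refine lintegral_eq_zero_of_ae_eq_zero ?_
    filter_upwards [measure_eq_zero_iff_ae_notMem.1 ih] with l hl
    rw [Qker_apply l hm]
    simp [Fmap_mem_Theta _ (Set.notMem_compl_iff.1 hl)]

theorem nonempty_Eset (τ : Equiv.Perm (Fin 3)) (i : Fin 2) : (Eset τ i).Nonempty := by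
  revert τ i
  decide

theorem Eset_cases (τ : Equiv.Perm (Fin 3)) :
    (Eset τ 0 = {0} ∧ Eset τ 1 = {1}) ∨ (Eset τ 0 = {1} ∧ Eset τ 1 = {0}) ∨
    (Eset τ 0 = {0} ∧ Eset τ 1 = {0, 1}) ∨ (Eset τ 0 = {0, 1} ∧ Eset τ 1 = {0}) ∨
    (Eset τ 0 = {1} ∧ Eset τ 1 = {0, 1}) ∨ (Eset τ 0 = {0, 1} ∧ Eset τ 1 = {1}) := by
  revert τ
  decide

theorem F_pos (τ : Equiv.Perm (Fin 3)) (i : Fin 2) {l : Fin 2 → ℝ} (hl : ∀ i, 0 < l i) :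
    0 < F τ i l :=
  Finset.sum_pos (fun j _ => Real.sqrt_pos.2 (by linarith [hl j])) (nonempty_Eset τ i)

theorem w_pos (τ : Equiv.Perm (Fin 3)) {l : Fin 2 → ℝ} (hl : ∀ i, 0 < l i) : 0 < w τ l :=
  mul_pos (by positivity) <| Finset.prod_pos fun i _ =>
    div_pos (Real.sqrt_pos.2 (by linarith [hl i])) (F_pos τ i hl)

theorem two_le_F (τ : Equiv.Perm (Fin 3)) (i : Fin 2) {l : Fin 2 → ℝ} (hl : ∀ i, 2 ≤ l i) :
    2 ≤ F τ i l := by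
  obtain ⟨j, hj⟩ := nonempty_Eset τ i
  refine le_trans (Real.le_sqrt_of_sq_le (by linarith [hl j])) <|
    Finset.single_le_sum (f := fun j => √(2 * l j)) (fun _ _ => Real.sqrt_nonneg _) hj

theorem two_le_of_mem_Theta {n : ℕ} {l : Fin 2 → ℝ} (hl : l ∈ Theta 2 n) (i : Fin 2) :
    2 ≤ l i := by
  induction n generalizing l i with
  | zero => exact (hl i).1
  | succ n ih =>
    obtain ⟨τ, l', hl', rfl⟩ := Set.mem_iUnion.1 hl
    exact two_le_F τ i (ih hl')

/-- The square of the Euclidean distance in the plane. -/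
def sqDist (p q : Fin 2 → ℝ) : ℝ := (p 0 - q 0) ^ 2 + (p 1 - q 1) ^ 2

theorem sq_sqrt_two_mul_sub_le {x y : ℝ} (hx : 2 ≤ x) (hy : 2 ≤ y) :
    4 * (√(2 * x) - √(2 * y)) ^ 2 ≤ (x - y) ^ 2 := by
  have h1 : 2 ≤ √(2 * x) := Real.le_sqrt_of_sq_le (by linarith)
  have h2 : 2 ≤ √(2 * y) := Real.le_sqrt_of_sq_le (by linarith)
  have h3 := Real.sq_sqrt (show 0 ≤ 2 * x by linarith)
  have h4 := Real.sq_sqrt (show 0 ≤ 2 * y by linarith)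
  have h5 : x - y = (√(2 * x) - √(2 * y)) * ((√(2 * x) + √(2 * y)) / 2) := by linarith
  rw [h5, mul_pow, mul_comm]
  exact mul_le_mul_of_nonneg_left (by nlinarith) (sq_nonneg _)

theorem sqDist_Fmap_le (τ : Equiv.Perm (Fin 3)) {p q : Fin 2 → ℝ} (hp : ∀ i, 2 ≤ p i)
    (hq : ∀ i, 2 ≤ q i) : sqDist (Fmap τ p) (Fmap τ q) ≤ 2 / 3 * sqDist p q := by
  have h0 := sq_sqrt_two_mul_sub_le (hp 0) (hq 0)
  have h1 := sq_sqrt_two_mul_sub_le (hp 1) (hq 1)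
  simp only [sqDist, Fmap, F]
  set a := √(2 * p 0) - √(2 * q 0) with ha
  set b := √(2 * p 1) - √(2 * q 1) with hb
  have hadd : √(2 * p 0) + √(2 * p 1) - (√(2 * q 0) + √(2 * q 1)) = a + b := by ring
  have h2 := sq_nonneg (a - b * (3 / 2))
  have h3 := sq_nonneg (b - a * (3 / 2))
  rcases Eset_cases τ with ⟨e0, e1⟩ | ⟨e0, e1⟩ | ⟨e0, e1⟩ | ⟨e0, e1⟩ | ⟨e0, e1⟩ | ⟨e0, e1⟩ <;>
    simp only [e0, e1, Finset.sum_singleton, Finset.sum_pair zero_ne_one, hadd, ← ha, ← hb] <;>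
    nlinarith [sq_nonneg a, sq_nonneg b]

theorem Fmap_mem_msupport {ν : Measure (Fin 2 → ℝ)} (hfix : ν.bind Qker = ν)
    (τ : Equiv.Perm (Fin 3)) {l : Fin 2 → ℝ} (hpos : ∀ i, 0 < l i) (hl : l ∈ msupport ν) :
    Fmap τ l ∈ msupport ν := by
  intro U hU hlU
  have hV : IsOpen ({l : Fin 2 → ℝ | ∀ i, 0 < l i} ∩ Fmap τ ⁻¹' U) := by
    refine IsOpen.inter ?_ (hU.preimage (continuous_Fmap τ))
    simp only [Set.ofPred_forall]
    exact isOpen_iInter_of_finite fun i => isOpen_lt continuous_const (continuous_apply i)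
  have hmeas : Measurable fun m : Fin 2 → ℝ => Qker m U :=
    (Measure.measurable_coe hU.measurableSet).comp measurable_Qker
  refine pos_iff_ne_zero.2 fun h0 => (hl _ hV ⟨hpos, hlU⟩).ne' ?_
  rw [← hfix, Measure.bind_apply hU.measurableSet measurable_Qker.aemeasurable,
    lintegral_eq_zero_iff (hmeas)] at h0
  refine measure_eq_zero_iff_ae_notMem.2 ?_
  filter_upwards [h0] with m hm ⟨hmpos, hmU⟩
  rw [Pi.zero_apply, Qker_apply m hU.measurableSet, Finset.sum_eq_zero_iff] at hm
  have := hm τ (Finset.mem_univ τ)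
  rw [Set.indicator_of_mem (Set.mem_preimage.1 hmU), Pi.one_apply, mul_one,
    ENNReal.ofReal_eq_zero] at this
  exact this.not_gt (w_pos τ hmpos)

theorem exists_sqDist_le_of_mem_Theta {S : Set (Fin 2 → ℝ)} (hne : S.Nonempty)
    (hS : S ⊆ Theta 2 0) (hmap : ∀ τ, ∀ l ∈ S, Fmap τ l ∈ S) {n : ℕ} {x : Fin 2 → ℝ}
    (hx : x ∈ Theta 2 n) : ∃ y ∈ S, sqDist x y ≤ (2 / 3) ^ n * 72 := by
  induction n generalizing x with
  | zero =>
    obtain ⟨y, hy⟩ := hne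
    refine ⟨y, hy, ?_⟩
    have h (i : Fin 2) : (x i - y i) ^ 2 ≤ 36 := by
      obtain ⟨h1, h2⟩ := hx i
      obtain ⟨h3, h4⟩ := hS hy i
      norm_num at h2 h4
      nlinarith
    have h0 := h 0
    have h1 := h 1
    simp only [sqDist]
    linarith
  | succ n ih =>
    obtain ⟨τ, x', hx', rfl⟩ := Set.mem_iUnion.1 hx
    obtain ⟨y, hy, hxy⟩ := ih hx'
    refine ⟨Fmap τ y, hmap τ y hy, ?_⟩
    have := sqDist_Fmap_le τ (two_le_of_mem_Theta hx') (two_le_of_mem_Theta (hS hy))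
    rw [pow_succ]
    exact this.trans (by linarith)

theorem iInter_Theta_subset_closure {S : Set (Fin 2 → ℝ)} (hne : S.Nonempty)
    (hS : S ⊆ Theta 2 0) (hmap : ∀ τ, ∀ l ∈ S, Fmap τ l ∈ S) :
    ⋂ n, Theta 2 n ⊆ closure S := by
  intro x hx
  refine Metric.mem_closure_iff.2 fun ε hε => ?_
  obtain ⟨n, hn⟩ := exists_pow_lt_of_lt_one (show 0 < ε ^ 2 / 72 by positivity)
    (show (2 / 3 : ℝ) < 1 by norm_num)
  obtain ⟨y, hy, hxy⟩ := exists_sqDist_le_of_mem_Theta hne hS hmap (Set.mem_iInter.1 hx n)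
  rw [lt_div_iff₀ (by norm_num)] at hn
  refine ⟨y, hy, (dist_pi_lt_iff hε).2 fun i => ?_⟩
  refine abs_lt_of_sq_lt_sq (lt_of_le_of_lt ?_ (hxy.trans_lt hn)) hε.le
  simp only [sqDist]
  fin_cases i
  · exact le_add_of_nonneg_right (sq_nonneg _)
  · exact le_add_of_nonneg_left (sq_nonneg _)

/-- for `k = 2`, if `ν` is a `Q`-invariant probability measure on
`(0,∞)²` with support contained in `[2,8]²`, then its support equals `Θ_2`. -/
theorem stmt16 (ν : Measure (Fin 2 → ℝ)) [IsProbabilityMeasure ν]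
    (hν : ν {l : Fin 2 → ℝ | ∀ i, 0 < l i} = 1)
    (hfix : ν.bind Qker = ν)
    (hsupp : msupport ν ⊆ {l : Fin 2 → ℝ | ∀ i, l i ∈ Set.Icc (2 : ℝ) 8}) :
    msupport ν = ⋂ n, Theta 2 n := by
  have hS : msupport ν ⊆ Theta 2 0 := by
    refine hsupp.trans fun l hl i => ?_
    convert hl i using 2
    norm_num
  have hnull : ν (msupport ν)ᶜ = 0 := by
    rw [msupport_eq_support]
    exact Measure.measure_compl_support
  have hclosed : IsClosed (msupport ν) := by
    rw [msupport_eq_support]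
    exact Measure.isClosed_support
  refine Set.Subset.antisymm (Set.subset_iInter fun n l hl => ?_) ?_
  · by_contra hln
    exact (hl _ (isCompact_Theta 2 n).isClosed.isOpen_compl hln).ne'
      (measure_compl_Theta hfix (measure_mono_null (Set.compl_subset_compl.2 hS) hnull) n)
  · have hne : (msupport ν).Nonempty := by
      by_contra h
      simp [Set.not_nonempty_iff_eq_empty.1 h] at hnull
    have hmap (τ) : ∀ l ∈ msupport ν, Fmap τ l ∈ msupport ν := fun l hl =>
      Fmap_mem_msupport hfix τ
        (fun i => zero_lt_two.trans_le (two_le_of_mem_Theta (hS hl) i)) hl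
    simpa [hclosed.closure_eq] using iInter_Theta_subset_closure hne hS hmap
end
end

section
/- Let k ≥ 1 and λ ∈ (0,∞)^k. Then for every x ∈ (0,∞)^k, ∫_{(0,∞)^k} (Π_{i=1}^k λ_i e^{−λ_i g_i}) Ψ^r_g(x) dg_1⋯dg_k = Σ_{D ⊆ {1,…,k}} Σ_{τ ∈ S(1..k)} w_{τ,D}(λ) Π_{i=1}^k F_{τ,D,i}(λ) e^{−F_{τ,D,i}(λ) x_i}. In words: the gaps operator of iterated reflected Brownian motion sends the product of exponential densities with rates λ_1,…,λ_k to the mixture, with weights w_{τ,D}(λ), of products of exponential densities with rates F_{τ,D,1}(λ),…,F_{τ,D,k}(λ). -/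
open MeasureTheory ProbabilityTheory Real Finset

noncomputable section

/-- Density of the centred Gaussian law with variance `g`. -/
def Phi (g y : ℝ) : ℝ := (Real.sqrt (2 * Real.pi * g))⁻¹ * Real.exp (-(y ^ 2) / (2 * g))

/-- Transition density of reflected Brownian motion:
`M_g(x,y) = Φ_g(y−x) + Φ_g(y+x)`. -/
def Mker (g x y : ℝ) : ℝ := Phi g (y - x) + Phi g (y + x)

/-- Partial sums: `x̄_j = x_1 + ⋯ + x_j`, with `x̄_0 = 0`. -/
def xbar {k : ℕ} (x : Fin k → ℝ) (j : Fin (k + 1)) : ℝ :=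
  ∑ i : Fin k, if (i : ℕ) < (j : ℕ) then x i else 0

/-- Extension of a permutation `τ` of `{1,…,k}` to `{0,1,…,k}` with the
convention `τ(0) = 0`. -/
def ext {k : ℕ} (τ : Equiv.Perm (Fin k)) : Fin (k + 1) → Fin (k + 1) :=
  Fin.cases 0 (fun j => (τ j).succ)

/-- `Ψ^r_g(x) = Σ_{τ ∈ S(1..k)} Π_{i=1}^k M_{g_i}(x̄_{τ(i−1)}, x̄_{τ(i)})`,
the gaps density for the reflected Brownian motion, with `τ(0) = 0`. -/
def PsiR {k : ℕ} (g x : Fin k → ℝ) : ℝ :=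
  ∑ τ : Equiv.Perm (Fin k), ∏ i : Fin k,
    Mker (g i) (xbar x (ext τ i.castSucc)) (xbar x (ext τ i.succ))

/-- `E_{τ,i} = { j : min(τ(j−1),τ(j)) < i ≤ max(τ(j−1),τ(j)) }` with `τ(0) = 0`
(index `j : Fin k` represents `j+1`, `i : Fin k` represents `i+1`). -/
def ER {k : ℕ} (τ : Equiv.Perm (Fin k)) (i : Fin k) : Finset (Fin k) :=
  Finset.univ.filter (fun j : Fin k =>
    min ((ext τ j.castSucc : Fin (k + 1)) : ℕ) ((ext τ j.succ : Fin (k + 1)) : ℕ) <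
        (i : ℕ) + 1 ∧
      (i : ℕ) + 1 ≤
        max ((ext τ j.castSucc : Fin (k + 1)) : ℕ) ((ext τ j.succ : Fin (k + 1)) : ℕ))

/-- `E′_{τ,i} = { j : τ(j) ≥ i }`. -/
def ER' {k : ℕ} (τ : Equiv.Perm (Fin k)) (i : Fin k) : Finset (Fin k) :=
  Finset.univ.filter (fun j : Fin k => (i : ℕ) + 1 ≤ ((ext τ j.succ : Fin (k + 1)) : ℕ))

/-- `E″_{τ,i} = { j : τ(j−1) ≥ i }`. -/
def ER'' {k : ℕ} (τ : Equiv.Perm (Fin k)) (i : Fin k) : Finset (Fin k) :=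
  Finset.univ.filter (fun j : Fin k => (i : ℕ) + 1 ≤ ((ext τ j.castSucc : Fin (k + 1)) : ℕ))

/-- `F_{τ,D,i}(λ) = Σ_{j ∈ D ∩ E_{τ,i}} √(2λ_j) + Σ_{j ∉ D, j ∈ E′_{τ,i}} √(2λ_j)
+ Σ_{j ∉ D, j ∈ E″_{τ,i}} √(2λ_j)`. -/
def FR {k : ℕ} (τ : Equiv.Perm (Fin k)) (D : Finset (Fin k)) (i : Fin k)
    (l : Fin k → ℝ) : ℝ :=
  (∑ j ∈ D ∩ ER τ i, Real.sqrt (2 * l j)) + (∑ j ∈ ER' τ i \ D, Real.sqrt (2 * l j)) +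
    ∑ j ∈ ER'' τ i \ D, Real.sqrt (2 * l j)

/-- `w_{τ,D}(λ) = 2^{−k} Π_{i=1}^k √(2λ_i)/F_{τ,D,i}(λ)`. -/
def wR {k : ℕ} (τ : Equiv.Perm (Fin k)) (D : Finset (Fin k)) (l : Fin k → ℝ) : ℝ :=
  (2 : ℝ)⁻¹ ^ k * ∏ i : Fin k, Real.sqrt (2 * l i) / FR τ D i l

open Filter Topology

/-- The integral of `exp (-v² / 2)` from `0` to `t`. -/
def gaussPrimitive (t : ℝ) : ℝ := ∫ v in (0 : ℝ)..t, Real.exp (-(1 / 2) * v ^ 2)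

lemma hasDerivAt_gaussPrimitive (t : ℝ) :
    HasDerivAt gaussPrimitive (Real.exp (-(1 / 2) * t ^ 2)) t := by
  have hc : Continuous fun v : ℝ => Real.exp (-(1 / 2) * v ^ 2) := by fun_prop
  exact (hc.integral_hasStrictDerivAt 0 t).hasDerivAt

lemma continuous_gaussPrimitive : Continuous gaussPrimitive :=
  continuous_iff_continuousAt.2 fun t => (hasDerivAt_gaussPrimitive t).continuousAt

lemma gaussPrimitive_zero : gaussPrimitive 0 = 0 := by simp [gaussPrimitive]

lemma gaussPrimitive_neg (t : ℝ) : gaussPrimitive (-t) = -gaussPrimitive t := by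
  have h := intervalIntegral.integral_comp_neg (a := 0) (b := t)
    (fun v : ℝ => Real.exp (-(1 / 2) * v ^ 2))
  simp only [even_two.neg_pow, neg_zero] at h
  rw [gaussPrimitive, gaussPrimitive, h, intervalIntegral.integral_symm]

lemma tendsto_gaussPrimitive_atTop :
    Tendsto gaussPrimitive atTop (𝓝 (Real.sqrt (2 * Real.pi) / 2)) := by
  have h := intervalIntegral_tendsto_integral_Ioi (μ := volume) (0 : ℝ)
    (integrable_exp_neg_mul_sq (b := 1 / 2) (by norm_num)).integrableOn tendsto_id
  rw [integral_gaussian_Ioi, show Real.pi / (1 / 2) = 2 * Real.pi by ring] at h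
  exact h

lemma tendsto_gaussPrimitive_atBot :
    Tendsto gaussPrimitive atBot (𝓝 (-(Real.sqrt (2 * Real.pi) / 2))) := by
  have h := (tendsto_gaussPrimitive_atTop.comp tendsto_neg_atBot_atTop).neg
  simpa [Function.comp_def, gaussPrimitive_neg] using h

/-- An antiderivative in `g` of `(s² / 2) exp (-(s² / 2) g) Φ_g(y)`. -/
def expPhiPrimitive (s y g : ℝ) : ℝ :=
  s / (2 * Real.sqrt (2 * Real.pi)) *
    (Real.exp (s * y) * gaussPrimitive (s * Real.sqrt g + y / Real.sqrt g) +
      Real.exp (-(s * y)) * gaussPrimitive (s * Real.sqrt g - y / Real.sqrt g))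

lemma hasDerivAt_expPhiPrimitive (s y : ℝ) {g : ℝ} (hg : 0 < g) :
    HasDerivAt (expPhiPrimitive s y)
      (s ^ 2 / 2 * Real.exp (-(s ^ 2 / 2 * g)) * Phi g y) g := by
  have hr : 0 < Real.sqrt g := Real.sqrt_pos.2 hg
  have hsq : HasDerivAt (fun g : ℝ => Real.sqrt g) (1 / (2 * Real.sqrt g)) g :=
    Real.hasDerivAt_sqrt hg.ne'
  have hdiv := (hasDerivAt_const g y).div hsq hr.ne'
  have hplus := (hasDerivAt_gaussPrimitive (s * Real.sqrt g + y / Real.sqrt g)).comp g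
    ((hsq.const_mul s).add hdiv)
  have hminus := (hasDerivAt_gaussPrimitive (s * Real.sqrt g - y / Real.sqrt g)).comp g
    ((hsq.const_mul s).sub hdiv)
  have h := ((hplus.const_mul (Real.exp (s * y))).add
    (hminus.const_mul (Real.exp (-(s * y))))).const_mul (s / (2 * Real.sqrt (2 * Real.pi)))
  refine h.congr_deriv ?_
  have hgr : g = Real.sqrt g ^ 2 := (Real.sq_sqrt hg.le).symm
  have e1 : Real.exp (s * y) * Real.exp (-(1 / 2) * (s * Real.sqrt g + y / Real.sqrt g) ^ 2) =
      Real.exp (-(s ^ 2 / 2 * g)) * Real.exp (-(y ^ 2) / (2 * g)) := by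
    rw [← Real.exp_add, ← Real.exp_add]
    congr 1
    generalize Real.sqrt g = r at *
    subst hgr
    field_simp
    ring
  have e2 : Real.exp (-(s * y)) * Real.exp (-(1 / 2) * (s * Real.sqrt g - y / Real.sqrt g) ^ 2) =
      Real.exp (-(s ^ 2 / 2 * g)) * Real.exp (-(y ^ 2) / (2 * g)) := by
    rw [← Real.exp_add, ← Real.exp_add]
    congr 1
    generalize Real.sqrt g = r at *
    subst hgr
    field_simp
    ring
  rw [← mul_assoc, ← mul_assoc, e1, e2, Phi, Real.sqrt_mul (by positivity) g]
  have hp : 0 < Real.sqrt (2 * Real.pi) := by positivity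
  field_simp
  ring

lemma tendsto_expPhiPrimitive_atTop {s : ℝ} (hs : 0 < s) (y : ℝ) :
    Tendsto (expPhiPrimitive s y) atTop
      (𝓝 (s / 4 * (Real.exp (s * y) + Real.exp (-(s * y))))) := by
  have h1 : Tendsto (fun g : ℝ => s * Real.sqrt g) atTop atTop :=
    Real.tendsto_sqrt_atTop.const_mul_atTop hs
  have h2 : Tendsto (fun g : ℝ => y / Real.sqrt g) atTop (𝓝 0) :=
    Real.tendsto_sqrt_atTop.const_div_atTop y
  have hplus := tendsto_gaussPrimitive_atTop.comp (h1.atTop_add h2)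
  have hminus := tendsto_gaussPrimitive_atTop.comp (h1.atTop_add h2.neg)
  have h := ((hplus.const_mul (Real.exp (s * y))).add
    (hminus.const_mul (Real.exp (-(s * y))))).const_mul (s / (2 * Real.sqrt (2 * Real.pi)))
  have hp : 0 < Real.sqrt (2 * Real.pi) := by positivity
  refine (h.congr fun g => ?_).trans (le_of_eq (congrArg 𝓝 ?_))
  · simp only [expPhiPrimitive, sub_eq_add_neg, Function.comp_apply]
  · field_simp
    ring

lemma tendsto_expPhiPrimitive_zero (s : ℝ) {y : ℝ} (hy : 0 ≤ y) :
    Tendsto (expPhiPrimitive s y) (𝓝[>] 0)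
      (𝓝 (s / 4 * (Real.exp (s * y) - Real.exp (-(s * y))))) := by
  have hsqrt : Tendsto (fun g : ℝ => Real.sqrt g) (𝓝[>] 0) (𝓝 0) := by
    have h := (Real.continuous_sqrt.tendsto 0).mono_left (nhdsWithin_le_nhds (s := Set.Ioi 0))
    simpa using h
  have h1 : Tendsto (fun g : ℝ => s * Real.sqrt g) (𝓝[>] 0) (𝓝 0) := by
    simpa using hsqrt.const_mul s
  rcases hy.eq_or_lt with rfl | hy
  · have hE : Tendsto (fun g : ℝ => gaussPrimitive (s * Real.sqrt g)) (𝓝[>] 0) (𝓝 0) := by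
      have h := (continuous_gaussPrimitive.tendsto 0).comp h1
      rwa [gaussPrimitive_zero] at h
    have h := (hE.add hE).const_mul (s / (2 * Real.sqrt (2 * Real.pi)))
    unfold expPhiPrimitive
    simpa using h
  · have hsqrt' : Tendsto (fun g : ℝ => Real.sqrt g) (𝓝[>] 0) (𝓝[>] 0) :=
      tendsto_nhdsWithin_iff.2 ⟨hsqrt, by
        filter_upwards [self_mem_nhdsWithin] with g hg using Real.sqrt_pos.2 hg⟩
    have h2 : Tendsto (fun g : ℝ => y / Real.sqrt g) (𝓝[>] 0) atTop := by
      simpa [div_eq_mul_inv, Function.comp_def] using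
        (tendsto_inv_nhdsGT_zero.comp hsqrt').const_mul_atTop hy
    have hplus := tendsto_gaussPrimitive_atTop.comp (h1.add_atTop h2)
    have hminus := tendsto_gaussPrimitive_atBot.comp
      (h1.add_atBot (tendsto_neg_atTop_atBot.comp h2))
    have h := ((hplus.const_mul (Real.exp (s * y))).add
      (hminus.const_mul (Real.exp (-(s * y))))).const_mul (s / (2 * Real.sqrt (2 * Real.pi)))
    have hp : 0 < Real.sqrt (2 * Real.pi) := by positivity
    refine (h.congr fun g => ?_).trans (le_of_eq (congrArg 𝓝 ?_))
    · simp only [expPhiPrimitive, sub_eq_add_neg, Function.comp_apply]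
    · field_simp
      ring

lemma Phi_nonneg (g y : ℝ) : 0 ≤ Phi g y := by unfold Phi; positivity

lemma Phi_abs (g y : ℝ) : Phi g |y| = Phi g y := by simp [Phi]

/-- The Laplace transform in the variance of the Gaussian density. -/
lemma integrableOn_and_integral_exp_mul_Phi {l : ℝ} (hl : 0 < l) (y : ℝ) :
    IntegrableOn (fun g => l * Real.exp (-(l * g)) * Phi g y) (Set.Ioi 0) ∧
      ∫ g in Set.Ioi (0 : ℝ), l * Real.exp (-(l * g)) * Phi g y =
        Real.sqrt (2 * l) / 2 * Real.exp (-(Real.sqrt (2 * l) * |y|)) := by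
  set s := Real.sqrt (2 * l) with hs_def
  have hs : 0 < s := Real.sqrt_pos.2 (by positivity)
  have hls : l = s ^ 2 / 2 := by rw [hs_def, Real.sq_sqrt (by positivity)]; ring
  rw [hls]
  simp_rw [← Phi_abs _ y]
  set m := s / 4 * (Real.exp (s * |y|) - Real.exp (-(s * |y|))) with hm
  have hcont : ContinuousWithinAt (Function.update (expPhiPrimitive s |y|) 0 m)
      (Set.Ici 0) 0 := by
    rw [continuousWithinAt_update_same, Set.Ici_sdiff_left]
    exact tendsto_expPhiPrimitive_zero s (abs_nonneg y)
  have hderiv : ∀ g ∈ Set.Ioi (0 : ℝ),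
      HasDerivAt (Function.update (expPhiPrimitive s |y|) 0 m)
        (s ^ 2 / 2 * Real.exp (-(s ^ 2 / 2 * g)) * Phi g |y|) g := by
    intro g hg
    refine (hasDerivAt_expPhiPrimitive s |y| hg).congr_of_eventuallyEq ?_
    filter_upwards [Ioi_mem_nhds hg] with u hu
    exact Function.update_of_ne (ne_of_gt hu) _ _
  have hnonneg : ∀ g ∈ Set.Ioi (0 : ℝ),
      0 ≤ s ^ 2 / 2 * Real.exp (-(s ^ 2 / 2 * g)) * Phi g |y| := fun g _ =>
    mul_nonneg (by positivity) (Phi_nonneg _ _)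
  have hlim : Tendsto (Function.update (expPhiPrimitive s |y|) 0 m) atTop
      (𝓝 (s / 4 * (Real.exp (s * |y|) + Real.exp (-(s * |y|))))) := by
    refine (tendsto_expPhiPrimitive_atTop hs |y|).congr' ?_
    filter_upwards [Ioi_mem_atTop (0 : ℝ)] with u hu
    exact (Function.update_of_ne (ne_of_gt hu) _ _).symm
  refine ⟨integrableOn_Ioi_deriv_of_nonneg hcont hderiv hnonneg hlim, ?_⟩
  rw [integral_Ioi_of_hasDerivAt_of_nonneg hcont hderiv hnonneg hlim, Function.update_self, hm]
  ring

lemma integrableOn_exp_mul_Mker {l : ℝ} (hl : 0 < l) (a b : ℝ) :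
    IntegrableOn (fun g => l * Real.exp (-(l * g)) * Mker g a b) (Set.Ioi 0) := by
  simp only [Mker, mul_add]
  exact (integrableOn_and_integral_exp_mul_Phi hl _).1.add
    (integrableOn_and_integral_exp_mul_Phi hl _).1

lemma integral_exp_mul_Mker {l : ℝ} (hl : 0 < l) {a b : ℝ} (ha : 0 ≤ a) (hb : 0 ≤ b) :
    ∫ g in Set.Ioi (0 : ℝ), l * Real.exp (-(l * g)) * Mker g a b =
      Real.sqrt (2 * l) / 2 * Real.exp (-(Real.sqrt (2 * l) * |b - a|)) +
        Real.sqrt (2 * l) / 2 * Real.exp (-(Real.sqrt (2 * l) * (b + a))) := by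
  simp only [Mker, mul_add (_ * _)]
  rw [integral_add (integrableOn_and_integral_exp_mul_Phi hl _).1
    (integrableOn_and_integral_exp_mul_Phi hl _).1,
    (integrableOn_and_integral_exp_mul_Phi hl _).2,
    (integrableOn_and_integral_exp_mul_Phi hl _).2, abs_of_nonneg (add_nonneg hb ha)]

lemma xbar_nonneg {k : ℕ} {x : Fin k → ℝ} (hx : ∀ i, 0 < x i) (j : Fin (k + 1)) :
    0 ≤ xbar x j :=
  Finset.sum_nonneg fun i _ => by split_ifs <;> [exact (hx i).le; exact le_rfl]

lemma abs_xbar_sub_xbar {k : ℕ} {x : Fin k → ℝ} (hx : ∀ i, 0 < x i) (p q : Fin (k + 1)) :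
    |xbar x q - xbar x p| =
      ∑ i : Fin k, if min (p : ℕ) (q : ℕ) < (i : ℕ) + 1 ∧ (i : ℕ) + 1 ≤ max (p : ℕ) (q : ℕ)
        then x i else 0 := by
  wlog hpq : (p : ℕ) ≤ q generalizing p q
  · rw [abs_sub_comm, this q p (le_of_not_ge hpq), min_comm, max_comm]
  have h : xbar x q - xbar x p =
      ∑ i : Fin k, if min (p : ℕ) (q : ℕ) < (i : ℕ) + 1 ∧ (i : ℕ) + 1 ≤ max (p : ℕ) (q : ℕ)
        then x i else 0 := by
    rw [xbar, xbar, ← Finset.sum_sub_distrib, min_eq_left hpq, max_eq_right hpq]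
    refine Finset.sum_congr rfl fun i _ => ?_
    split_ifs <;> first | omega | simp
  rw [h, abs_of_nonneg]
  exact Finset.sum_nonneg fun i _ => by split_ifs <;> [exact (hx i).le; exact le_rfl]

lemma sum_FR_mul {k : ℕ} (τ : Equiv.Perm (Fin k)) (D : Finset (Fin k)) (l : Fin k → ℝ)
    {x : Fin k → ℝ} (hx : ∀ i, 0 < x i) :
    ∑ i, FR τ D i l * x i =
      (∑ j ∈ D, Real.sqrt (2 * l j) *
        |xbar x (ext τ j.succ) - xbar x (ext τ j.castSucc)|) +
      ∑ j ∈ Dᶜ, Real.sqrt (2 * l j) *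
        (xbar x (ext τ j.succ) + xbar x (ext τ j.castSucc)) := by
  have hE (i : Fin k) : ∑ j ∈ D ∩ ER τ i, Real.sqrt (2 * l j) =
      ∑ j ∈ D, if j ∈ ER τ i then Real.sqrt (2 * l j) else 0 := by
    rw [← Finset.sum_filter, Finset.filter_mem_eq_inter]
  have hE' (A : Finset (Fin k)) : ∑ j ∈ A \ D, Real.sqrt (2 * l j) =
      ∑ j ∈ Dᶜ, if j ∈ A then Real.sqrt (2 * l j) else 0 := by
    rw [← Finset.sum_filter, Finset.filter_mem_eq_inter, Finset.inter_comm,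
      Finset.sdiff_eq_inter_compl]
  simp only [FR, hE, hE', add_mul, Finset.sum_add_distrib, mul_add, Finset.sum_mul, add_assoc]
  congr 1
  · rw [Finset.sum_comm]
    refine Finset.sum_congr rfl fun j _ => ?_
    rw [abs_xbar_sub_xbar hx, Finset.mul_sum]
    refine Finset.sum_congr rfl fun i _ => ?_
    simp [ER]
  · congr 1
    all_goals
      rw [Finset.sum_comm]
      refine Finset.sum_congr rfl fun j _ => ?_
      rw [xbar, Finset.mul_sum]
      refine Finset.sum_congr rfl fun i _ => ?_
      simp [ER', ER'', Order.add_one_le_iff]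

lemma exists_ext_lt_and_le {k : ℕ} (τ : Equiv.Perm (Fin k)) (i : Fin k) :
    ∃ j : Fin k, (ext τ j.castSucc : ℕ) < (i : ℕ) + 1 ∧ (i : ℕ) + 1 ≤ (ext τ j.succ : ℕ) := by
  by_contra! h
  have hall : ∀ n : Fin (k + 1), (ext τ n : ℕ) < (i : ℕ) + 1 := by
    intro n
    induction n using Fin.induction with
    | zero => simp [_root_.ext]
    | succ j ih => exact h j ih
  simpa [_root_.ext] using hall (τ.symm i).succ

lemma FR_pos {k : ℕ} (τ : Equiv.Perm (Fin k)) (D : Finset (Fin k)) (i : Fin k)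
    {l : Fin k → ℝ} (hl : ∀ i, 0 < l i) : 0 < FR τ D i l := by
  have hs (j : Fin k) : 0 < Real.sqrt (2 * l j) := Real.sqrt_pos.2 (mul_pos two_pos (hl j))
  have hsum (A : Finset (Fin k)) : 0 ≤ ∑ j ∈ A, Real.sqrt (2 * l j) :=
    Finset.sum_nonneg fun j _ => (hs j).le
  have hsum' {A : Finset (Fin k)} {j : Fin k} (hj : j ∈ A) : 0 < ∑ j ∈ A, Real.sqrt (2 * l j) :=
    Finset.sum_pos (fun j _ => hs j) ⟨j, hj⟩
  obtain ⟨j, hj, hj'⟩ := exists_ext_lt_and_le τ i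
  unfold FR
  by_cases hD : j ∈ D
  · have hmem : j ∈ D ∩ ER τ i := by
      simp only [ER, Finset.mem_inter, Finset.mem_filter, Finset.mem_univ, true_and]
      exact ⟨hD, min_lt_of_left_lt hj, le_max_of_le_right hj'⟩
    have := hsum' hmem
    linarith [hsum (ER' τ i \ D), hsum (ER'' τ i \ D)]
  · have hmem : j ∈ ER' τ i \ D := by
      simp only [ER', Finset.mem_sdiff, Finset.mem_filter, Finset.mem_univ, true_and]
      exact ⟨hj', hD⟩
    have := hsum' hmem
    linarith [hsum (D ∩ ER τ i), hsum (ER'' τ i \ D)]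

lemma wR_mul_prod {k : ℕ} (τ : Equiv.Perm (Fin k)) (D : Finset (Fin k))
    {l : Fin k → ℝ} (hl : ∀ i, 0 < l i) {x : Fin k → ℝ} (hx : ∀ i, 0 < x i) :
    wR τ D l * ∏ i, FR τ D i l * Real.exp (-(FR τ D i l * x i)) =
      (∏ j ∈ D, Real.sqrt (2 * l j) / 2 * Real.exp (-(Real.sqrt (2 * l j) *
        |xbar x (ext τ j.succ) - xbar x (ext τ j.castSucc)|))) *
      ∏ j ∈ Dᶜ, Real.sqrt (2 * l j) / 2 * Real.exp (-(Real.sqrt (2 * l j) *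
        (xbar x (ext τ j.succ) + xbar x (ext τ j.castSucc)))) := by
  have hF : ∏ i, FR τ D i l ≠ 0 := Finset.prod_ne_zero_iff.2 fun i _ => (FR_pos τ D i hl).ne'
  have hpow : (2 : ℝ)⁻¹ ^ k = ∏ _i : Fin k, (2 : ℝ)⁻¹ := by simp
  have hhalf : (2 : ℝ)⁻¹ ^ k * ∏ i, Real.sqrt (2 * l i) = ∏ i, Real.sqrt (2 * l i) / 2 := by
    rw [hpow, ← Finset.prod_mul_distrib]
    exact Finset.prod_congr rfl fun i _ => by ring
  simp only [Finset.prod_mul_distrib]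
  rw [mul_mul_mul_comm, Finset.prod_mul_prod_compl, ← Real.exp_sum, ← Real.exp_sum,
    ← Real.exp_sum, ← Real.exp_add]
  simp only [Finset.sum_neg_distrib]
  rw [← neg_add, ← sum_FR_mul τ D l hx, wR, Finset.prod_div_distrib, ← hhalf]
  field_simp

/-- the gaps operator of iterated reflected Brownian motion sends the
product of exponential densities with rates `λ_1,…,λ_k` to the mixture, with weights
`w_{τ,D}(λ)`, of products of exponential densities with rates `F_{τ,D,i}(λ)`. -/
theorem stmt17 {k : ℕ} (hk : 1 ≤ k) (l : Fin k → ℝ) (hl : ∀ i, 0 < l i)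
    (x : Fin k → ℝ) (hx : ∀ i, 0 < x i) :
    ∫ g in {g : Fin k → ℝ | ∀ i, 0 < g i},
        (∏ i : Fin k, l i * Real.exp (-(l i * g i))) * PsiR g x =
      ∑ D : Finset (Fin k), ∑ τ : Equiv.Perm (Fin k),
        wR τ D l * ∏ i : Fin k, FR τ D i l * Real.exp (-(FR τ D i l * x i)) := by
  have hset : {g : Fin k → ℝ | ∀ i, 0 < g i} = Set.univ.pi fun _ => Set.Ioi 0 := by
    ext g
    simp
  have hμ : (volume : Measure (Fin k → ℝ)).restrict {g | ∀ i, 0 < g i} =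
      Measure.pi fun _ => volume.restrict (Set.Ioi 0) := by
    rw [hset, volume_pi, Measure.restrict_pi_pi]
  rw [hμ, Finset.sum_comm]
  simp only [PsiR, Finset.mul_sum, ← Finset.prod_mul_distrib]
  rw [integral_finsetSum]
  · refine Finset.sum_congr rfl fun τ _ => ?_
    rw [integral_fintype_prod_eq_prod (fun i g => l i * Real.exp (-(l i * g)) *
      Mker g (xbar x (_root_.ext τ i.castSucc)) (xbar x (_root_.ext τ i.succ)))]
    simp only [integral_exp_mul_Mker (hl _) (xbar_nonneg hx _) (xbar_nonneg hx _)]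
    rw [Fintype.prod_add]
    exact Finset.sum_congr rfl fun D _ => (wR_mul_prod τ D hl hx).symm
  · intro τ _
    exact Integrable.fintype_prod (f := fun i g => l i * Real.exp (-(l i * g)) *
      Mker g (xbar x (_root_.ext τ i.castSucc)) (xbar x (_root_.ext τ i.succ)))
      fun i => integrableOn_exp_mul_Mker (hl i) _ _
end
end

section
/- Let k ≥ 1. For every permutation τ of {1,…,k}, every subset D ⊆ {1,…,k}, and every λ ∈ [2, 18k²]^k, one has F_{τ,D}(λ) = (F_{τ,D,1}(λ),…,F_{τ,D,k}(λ)) ∈ [2, 18k²]^k; that is, the compact cube [2,18k²]^k is conserved by each of the maps F_{τ,D} arising in the reflected Brownian motion case. -/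
open MeasureTheory ProbabilityTheory Real Finset

noncomputable section

/-- The path `τ(0) = 0, τ(1), …, τ(k)` crosses every level `i` from below. -/
theorem exists_upcrossing {k : ℕ} (τ : Equiv.Perm (Fin k)) (i : Fin k) :
    ∃ j : Fin k, ((ext τ j.castSucc : Fin (k + 1)) : ℕ) < (i : ℕ) + 1 ∧
      (i : ℕ) + 1 ≤ ((ext τ j.succ : Fin (k + 1)) : ℕ) := by
  by_contra! h
  have below : ∀ m : Fin (k + 1), ((ext τ m : Fin (k + 1)) : ℕ) < (i : ℕ) + 1 := by
    intro m
    induction m using Fin.induction with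
    | zero => simp [_root_.ext]
    | succ j ih => exact h j ih
  simpa [_root_.ext] using below (τ.symm i).succ

theorem two_le_FR {k : ℕ} (τ : Equiv.Perm (Fin k)) (D : Finset (Fin k)) (i : Fin k)
    {l : Fin k → ℝ} (hl : ∀ j, 2 ≤ l j) : 2 ≤ FR τ D i l := by
  have two_le_sqrt : ∀ j, 2 ≤ √(2 * l j) := fun j =>
    Real.le_sqrt_of_sq_le (by linarith [hl j])
  have sum_nonneg' : ∀ s : Finset (Fin k), 0 ≤ ∑ j ∈ s, √(2 * l j) := fun s =>
    Finset.sum_nonneg fun j _ => Real.sqrt_nonneg _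
  have two_le_sum : ∀ (s : Finset (Fin k)) (j), j ∈ s → 2 ≤ ∑ j ∈ s, √(2 * l j) :=
    fun s j hj => (two_le_sqrt j).trans <|
      Finset.single_le_sum (f := fun j => √(2 * l j)) (fun _ _ => Real.sqrt_nonneg _) hj
  obtain ⟨j, hlt, hle⟩ := exists_upcrossing τ i
  have hE := sum_nonneg' (D ∩ ER τ i)
  have hE' := sum_nonneg' (ER' τ i \ D)
  have hE'' := sum_nonneg' (ER'' τ i \ D)
  unfold FR
  by_cases hj : j ∈ D
  · have := two_le_sum (D ∩ ER τ i) j <| Finset.mem_inter.2 ⟨hj, Finset.mem_filter.2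
      ⟨Finset.mem_univ j, min_lt_of_left_lt hlt, le_max_of_le_right hle⟩⟩
    linarith
  · have := two_le_sum (ER' τ i \ D) j <| Finset.mem_sdiff.2
      ⟨Finset.mem_filter.2 ⟨Finset.mem_univ j, hle⟩, hj⟩
    linarith

theorem FR_le_two_mul_sum {k : ℕ} (τ : Equiv.Perm (Fin k)) (D : Finset (Fin k)) (i : Fin k)
    (l : Fin k → ℝ) : FR τ D i l ≤ 2 * ∑ j, √(2 * l j) := by
  have sum_mono : ∀ {s t : Finset (Fin k)}, s ⊆ t → ∑ j ∈ s, √(2 * l j) ≤ ∑ j ∈ t, √(2 * l j) :=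
    fun h => Finset.sum_le_sum_of_subset_of_nonneg h fun _ _ _ => Real.sqrt_nonneg _
  have hD : ∑ j ∈ D ∩ ER τ i, √(2 * l j) ≤ ∑ j ∈ D, √(2 * l j) :=
    sum_mono Finset.inter_subset_left
  have hE' : ∑ j ∈ ER' τ i \ D, √(2 * l j) ≤ ∑ j ∈ univ \ D, √(2 * l j) :=
    sum_mono (Finset.sdiff_subset_sdiff (Finset.subset_univ _) subset_rfl)
  have hE'' : ∑ j ∈ ER'' τ i \ D, √(2 * l j) ≤ ∑ j ∈ univ, √(2 * l j) :=
    sum_mono (Finset.subset_univ _)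
  have split := Finset.sum_sdiff (f := fun j => √(2 * l j)) (Finset.subset_univ D)
  unfold FR
  linarith

/-- the compact cube `[2, 18k²]^k` is conserved by each of the maps
`F_{τ,D}` arising in the reflected Brownian motion case. -/
theorem stmt18 {k : ℕ} (hk : 1 ≤ k) (τ : Equiv.Perm (Fin k)) (D : Finset (Fin k))
    (l : Fin k → ℝ) (hl : ∀ i, l i ∈ Set.Icc (2 : ℝ) (18 * (k : ℝ) ^ 2)) :
    ∀ i, FR τ D i l ∈ Set.Icc (2 : ℝ) (18 * (k : ℝ) ^ 2) := by
  intro i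
  refine ⟨two_le_FR τ D i fun j => (hl j).1, ?_⟩
  have sqrt_le : ∀ j, √(2 * l j) ≤ 6 * (k : ℝ) := fun j =>
    Real.sqrt_le_iff.2 ⟨by positivity, by nlinarith [(hl j).2]⟩
  calc FR τ D i l ≤ 2 * ∑ j, √(2 * l j) := FR_le_two_mul_sum τ D i l
    _ ≤ 2 * ∑ _j : Fin k, 6 * (k : ℝ) := by gcongr with j; exact sqrt_le j
    _ = 12 * (k : ℝ) ^ 2 := by
      simp only [Finset.sum_const, Finset.card_univ, Fintype.card_fin, nsmul_eq_mul]
      ring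
    _ ≤ 18 * (k : ℝ) ^ 2 := by gcongr; norm_num
end
end
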